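/- Fix x ∈ ℝ^d and 0 ≤ ε₂ < 1, and for each i let x̃_i ∈ ℝ^d satisfy ‖x̃_i − prox_{γf_i}(x)‖² ≤ ε₂ · ‖x − prox_{γf_i}(x)‖². Then the averaged bias satisfies ‖(1/n)∑_i (x̃_i − prox_{γf_i}(x))‖² ≤ (4ε₂L_max/μ) · ‖γ∇M^γ(x)‖². Consequently, the mapping γ∇M^γ(x) ↦ γ∇M^γ(x) − (1/n)∑_i (x̃_i − prox_{γf_i}(x)) satisfies the B³ compression property with constant δ = μ/(μ − 4ε₂L_max) whenever ε₂ < μ/(4L_max). -/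

import Mathlib

open scoped RealInnerProductSpace

theorem StrongConvexOn.quadratic_growth {E : Type*} [NormedAddCommGroup E] [NormedSpace ℝ E]
    {f : E → ℝ} {μ : ℝ} (hf : StrongConvexOn Set.univ μ f) {x₀ : E}
    (hmin : ∀ y, f x₀ ≤ f y) (x : E) : μ / 2 * ‖x - x₀‖ ^ 2 ≤ f x - f x₀ := by
  have key : ∀ b ∈ Set.Ioo (0 : ℝ) 1, (1 - b) * (μ / 2 * ‖x - x₀‖ ^ 2) ≤ f x - f x₀ := by
    rintro b ⟨hb₀, hb₁⟩
    have h := hf.2 (Set.mem_univ x) (Set.mem_univ x₀) hb₀.le (sub_nonneg.2 hb₁.le)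
      (add_sub_cancel b 1)
    simp only [smul_eq_mul] at h
    have := (hmin _).trans h
    refine le_of_mul_le_mul_left ?_ hb₀
    linarith
  have hlim : Filter.Tendsto (fun b : ℝ => (1 - b) * (μ / 2 * ‖x - x₀‖ ^ 2))
      (nhdsWithin 0 (Set.Ioi 0)) (nhds (μ / 2 * ‖x - x₀‖ ^ 2)) := by
    have : Continuous fun b : ℝ => (1 - b) * (μ / 2 * ‖x - x₀‖ ^ 2) := by fun_prop
    simpa using (this.tendsto 0).mono_left nhdsWithin_le_nhds
  exact le_of_tendsto hlim
    (Filter.eventually_of_mem (Ioo_mem_nhdsGT one_pos) key)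

section FirstOrder

variable {E : Type*} [NormedAddCommGroup E] [InnerProductSpace ℝ E] [CompleteSpace E]

theorem HasGradientAt.hasDerivAt_comp_line {f : E → ℝ} {g x v : E} {t : ℝ}
    (h : HasGradientAt f g (x + t • v)) : HasDerivAt (fun s : ℝ => f (x + s • v)) ⟪g, v⟫ t := by
  have hline : HasDerivAt (fun s : ℝ => x + s • v) v t := by
    simpa using ((hasDerivAt_id t).smul_const v).const_add x
  simpa [Function.comp_def] using h.hasFDerivAt.comp_hasDerivAt t hline

theorem ConvexOn.add_inner_gradient_le {f : E → ℝ} (hf : ConvexOn ℝ Set.univ f) {g x : E}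
    (hg : HasGradientAt f g x) (y : E) : f x + ⟪g, y - x⟫ ≤ f y := by
  have hline : ConvexOn ℝ Set.univ (fun s : ℝ => f (x + s • (y - x))) := by
    have := hf.comp_affineMap (AffineMap.lineMap (k := ℝ) x y)
    simpa [Function.comp_def, AffineMap.lineMap_apply, add_comm] using this
  have hderiv : HasDerivAt (fun s : ℝ => f (x + s • (y - x))) ⟪g, y - x⟫ 0 :=
    HasGradientAt.hasDerivAt_comp_line (by simpa using hg)
  have := hline.le_slope_of_hasDerivAt (Set.mem_univ 0) (Set.mem_univ 1) one_pos hderiv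
  simp [slope_def_field] at this
  linarith

/-- The quadratic upper bound for functions with Lipschitz gradient. -/
theorem le_add_inner_gradient_add_sq {f : E → ℝ} {f' : E → E} {L : ℝ}
    (hf : ∀ x, HasGradientAt f (f' x) x) (hL : ∀ x y, ‖f' x - f' y‖ ≤ L * ‖x - y‖) (x v : E) :
    f (x + v) ≤ f x + ⟪f' x, v⟫ + L / 2 * ‖v‖ ^ 2 := by
  have hderiv : ∀ t : ℝ, HasDerivAt
      (fun s : ℝ => f (x + s • v) - s * ⟪f' x, v⟫ - s ^ 2 * (L / 2 * ‖v‖ ^ 2))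
      (⟪f' (x + t • v), v⟫ - ⟪f' x, v⟫ - 2 * t * (L / 2 * ‖v‖ ^ 2)) t := by
    intro t
    have h₁ := (hasDerivAt_id t).mul_const ⟪f' x, v⟫
    have h₂ := (hasDerivAt_pow 2 t).mul_const (L / 2 * ‖v‖ ^ 2)
    simpa using ((hf (x + t • v)).hasDerivAt_comp_line.fun_sub h₁).fun_sub h₂
  have hanti : AntitoneOn
      (fun s : ℝ => f (x + s • v) - s * ⟪f' x, v⟫ - s ^ 2 * (L / 2 * ‖v‖ ^ 2)) (Set.Ici 0) := by
    refine antitoneOn_of_deriv_nonpos (convex_Ici 0)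
      (fun t _ => (hderiv t).continuousAt.continuousWithinAt)
      (fun t _ => (hderiv t).differentiableAt.differentiableWithinAt) fun t ht => ?_
    rw [interior_Ici, Set.mem_Ioi] at ht
    rw [(hderiv t).deriv, ← inner_sub_left]
    have h₁ := real_inner_le_norm (f' (x + t • v) - f' x) v
    have h₂ : ‖f' (x + t • v) - f' x‖ ≤ L * (t * ‖v‖) := by
      simpa [norm_smul, abs_of_pos ht] using hL (x + t • v) x
    nlinarith [mul_le_mul_of_nonneg_right h₂ (norm_nonneg v)]
  have := hanti Set.self_mem_Ici (Set.mem_Ici.2 zero_le_one) zero_le_one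
  simp at this
  linarith

theorem norm_gradient_sq_le_of_forall_le {f : E → ℝ} {f' : E → E} {L : ℝ} (hLpos : 0 < L)
    (hf : ∀ x, HasGradientAt f (f' x) x) (hL : ∀ x y, ‖f' x - f' y‖ ≤ L * ‖x - y‖)
    {m : ℝ} (hm : ∀ y, m ≤ f y) (x : E) : ‖f' x‖ ^ 2 ≤ 2 * L * (f x - m) := by
  have h := (hm _).trans (le_add_inner_gradient_add_sq hf hL x (-(1 / L) • f' x))
  rw [inner_smul_right, real_inner_self_eq_norm_sq, norm_smul, mul_pow, Real.norm_eq_abs,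
    sq_abs] at h
  have hsq : -(1 / L) * ‖f' x‖ ^ 2 + L / 2 * ((-(1 / L)) ^ 2 * ‖f' x‖ ^ 2)
      = -(‖f' x‖ ^ 2 / (2 * L)) := by
    field_simp
    ring
  have h' : ‖f' x‖ ^ 2 / (2 * L) ≤ f x - m := by linarith
  rwa [div_le_iff₀ (by positivity), mul_comm] at h'

/-- Optimality condition for the proximal point `p` of a differentiable function at `x`. -/
theorem sub_eq_smul_gradient_of_isMinOn_prox {f : E → ℝ} {g x p : E} {γ : ℝ} (hγ : 0 < γ)
    (hg : HasGradientAt f g p)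
    (hp : IsMinOn (fun z => f z + ‖z - x‖ ^ 2 / (2 * γ)) Set.univ p) : x - p = γ • g := by
  have hsq : HasFDerivAt (fun z : E => ‖z - x‖ ^ 2) (2 • innerSL ℝ (p - x)) p := by
    simpa using ((hasFDerivAt_id p).sub_const x).norm_sq
  have hsum : HasFDerivAt (fun z => f z + ‖z - x‖ ^ 2 / (2 * γ))
      (InnerProductSpace.toDual ℝ E g + (2 * γ)⁻¹ • 2 • innerSL ℝ (p - x)) p := by
    simpa only [div_eq_mul_inv] using hg.hasFDerivAt.fun_add (hsq.mul_const (2 * γ)⁻¹)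
  have hzero := (hp.isLocalMin Filter.univ_mem).hasFDerivAt_eq_zero hsum
  have hv : ⟪g + γ⁻¹ • (p - x), g + γ⁻¹ • (p - x)⟫ = 0 := by
    have := DFunLike.congr_fun hzero (g + γ⁻¹ • (p - x))
    simp only [add_apply, smul_apply, InnerProductSpace.toDual_apply_apply, innerSL_apply_apply,
      zero_apply, smul_eq_mul, nsmul_eq_mul] at this
    rw [inner_add_left g, real_inner_smul_left, ← this]
    push_cast
    field_simp
  have hg' : g = γ⁻¹ • (x - p) := by
    rw [eq_comm, ← sub_eq_zero, ← neg_eq_zero, ← inner_self_eq_zero.1 hv]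
    module
  rw [hg', smul_inv_smul₀ hγ.ne']

variable {f : E → ℝ} {f' : E → E} {L γ : ℝ} {x₀ x p : E}

theorem norm_sub_prox_sq_le (hLpos : 0 < L) (hγ : 0 < γ) (hconv : ConvexOn ℝ Set.univ f)
    (hf : ∀ x, HasGradientAt f (f' x) x) (hL : ∀ x y, ‖f' x - f' y‖ ≤ L * ‖x - y‖)
    (hmin : ∀ y, f x₀ ≤ f y) (hp : x - p = γ • f' p) :
    (1 + γ * L) * ‖x - p‖ ^ 2 ≤ 2 * γ * L * ⟪x - p, x - x₀⟫ := by
  have h₁ := norm_gradient_sq_le_of_forall_le hLpos hf hL hmin p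
  have h₂ := hconv.add_inner_gradient_le (hf p) x₀
  have h₃ : ⟪x - p, x - x₀⟫ = γ * (γ * ‖f' p‖ ^ 2 - ⟪f' p, x₀ - p⟫) := by
    rw [show x - x₀ = (x - p) - (x₀ - p) by abel, hp, real_inner_smul_left, inner_sub_right,
      real_inner_smul_right, real_inner_self_eq_norm_sq]
  have h₄ : ‖x - p‖ ^ 2 = γ ^ 2 * ‖f' p‖ ^ 2 := by
    rw [hp, norm_smul, mul_pow, Real.norm_eq_abs, sq_abs]
  have h₅ : ‖f' p‖ ^ 2 ≤ 2 * L * -⟪f' p, x₀ - p⟫ :=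
    h₁.trans (mul_le_mul_of_nonneg_left (by linarith) (by positivity))
  rw [h₃, h₄]
  have h₆ : 0 ≤ γ ^ 2 * (γ * L * ‖f' p‖ ^ 2) := by positivity
  nlinarith [mul_le_mul_of_nonneg_left h₅ (sq_nonneg γ)]

theorem mul_sub_le_inner_sub_prox (hLpos : 0 < L) (hγ : 0 < γ) (hconv : ConvexOn ℝ Set.univ f)
    (hf : ∀ x, HasGradientAt f (f' x) x) (hL : ∀ x y, ‖f' x - f' y‖ ≤ L * ‖x - y‖)
    (hmin : ∀ y, f x₀ ≤ f y) (hp : x - p = γ • f' p) :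
    γ * (f x - f x₀) ≤ (1 + γ * L) * ⟪x - p, x - x₀⟫ := by
  have h₁ := hconv.add_inner_gradient_le (hf x) p
  have h₂ := hconv.add_inner_gradient_le (hf p) x₀
  have h₃ : ⟪x - p, x - x₀⟫ = ‖x - p‖ ^ 2 - γ * ⟪f' p, x₀ - p⟫ := by
    rw [show x - x₀ = (x - p) - (x₀ - p) by abel, inner_sub_right,
      real_inner_self_eq_norm_sq, hp, real_inner_smul_left]
  have h₄ : ⟪f' x, p - x⟫ = -(⟪f' x - f' p, x - p⟫ + ⟪f' p, x - p⟫) := by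
    rw [← inner_add_left, sub_add_cancel, ← inner_neg_right, neg_sub]
  have h₅ : γ * ⟪f' p, x - p⟫ = ‖x - p‖ ^ 2 := by
    rw [← real_inner_smul_left, ← hp, real_inner_self_eq_norm_sq]
  have h₆ : ⟪f' x - f' p, x - p⟫ ≤ L * ‖x - p‖ ^ 2 := by
    refine (real_inner_le_norm _ _).trans ?_
    nlinarith [mul_le_mul_of_nonneg_right (hL x p) (norm_nonneg (x - p))]
  have h₇ : 0 ≤ -⟪f' p, x₀ - p⟫ := by linarith [hmin p]
  have h₈ : f x - f x₀ ≤ L * ‖x - p‖ ^ 2 + ⟪f' p, x - p⟫ - ⟪f' p, x₀ - p⟫ := by linarith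
  have h₉ : 0 ≤ γ * L * (γ * -⟪f' p, x₀ - p⟫) := by positivity
  rw [h₃]
  nlinarith [mul_le_mul_of_nonneg_left h₈ hγ.le]

end FirstOrder

theorem norm_mean_sq_le {ι E : Type*} [Fintype ι] [NormedAddCommGroup E] [NormedSpace ℝ E]
    (v : ι → E) :
    ‖(1 / (Fintype.card ι : ℝ)) • ∑ i, v i‖ ^ 2
      ≤ 1 / (Fintype.card ι : ℝ) * ∑ i, ‖v i‖ ^ 2 := by
  have h : ‖∑ i, v i‖ ^ 2 ≤ Fintype.card ι * ∑ i, ‖v i‖ ^ 2 :=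
    (pow_le_pow_left₀ (norm_nonneg _) (norm_sum_le _ _) 2).trans sq_sum_le_card_mul_sum_sq
  rcases (Nat.cast_nonneg (α := ℝ) (Fintype.card ι)).eq_or_lt with h₀ | h₀
  · simp [← h₀]
  · rw [norm_smul, mul_pow, Real.norm_eq_abs, sq_abs]
    calc (1 / (Fintype.card ι : ℝ)) ^ 2 * ‖∑ i, v i‖ ^ 2
        ≤ (1 / (Fintype.card ι : ℝ)) ^ 2 * (Fintype.card ι * ∑ i, ‖v i‖ ^ 2) := by gcongr
      _ = 1 / (Fintype.card ι : ℝ) * ∑ i, ‖v i‖ ^ 2 := by field_simp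

theorem le_mul_sq_of_inner_bounds {A D L γ c s μ : ℝ} (hL : 0 < L) (hγ : 0 < γ) (hμ : 0 < μ)
    (hD : 0 ≤ D) (hA : (1 + γ * L) * A ≤ 2 * γ * L * c)
    (hc : γ * (μ / 2 * D ^ 2) ≤ (1 + γ * L) * c) (hs : c ≤ s * D) : A ≤ 4 * L / μ * s ^ 2 := by
  have hpos : 0 < 1 + γ * L := by positivity
  rcases hD.eq_or_lt with rfl | hD
  · have hA₀ : A ≤ 0 := by
      refine nonpos_of_mul_nonpos_right (hA.trans ?_) hpos
      exact mul_nonpos_of_nonneg_of_nonpos (by positivity) (by simpa using hs)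
    exact hA₀.trans (by positivity)
  · have hD' : γ * μ * D ≤ 2 * (1 + γ * L) * s := by
      refine le_of_mul_le_mul_right ?_ hD
      nlinarith [mul_le_mul_of_nonneg_left hs hpos.le]
    have hs₀ : 0 ≤ s := by
      refine nonneg_of_mul_nonneg_right (a := 2 * (1 + γ * L)) ?_ (by positivity)
      exact le_trans (by positivity) hD'
    rw [div_mul_eq_mul_div, le_div_iff₀ hμ]
    refine le_of_mul_le_mul_left ?_ hpos
    calc (1 + γ * L) * (A * μ) = μ * ((1 + γ * L) * A) := by ring
      _ ≤ μ * (2 * γ * L * (s * D)) :=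
        mul_le_mul_of_nonneg_left (hA.trans (by gcongr)) hμ.le
      _ = 2 * L * s * (γ * μ * D) := by ring
      _ ≤ 2 * L * s * (2 * (1 + γ * L) * s) := by gcongr
      _ = (1 + γ * L) * (4 * L * s ^ 2) := by ring

theorem bias_b3_property
    {d n : ℕ} (hn : 1 ≤ n)
    (f : Fin n → EuclideanSpace ℝ (Fin d) → ℝ)
    (f' : Fin n → EuclideanSpace ℝ (Fin d) → EuclideanSpace ℝ (Fin d))
    (L : Fin n → ℝ) (hLpos : ∀ i, 0 < L i)
    (hdiff : ∀ i x, HasGradientAt (f i) (f' i x) x)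
    (hconv : ∀ i, ConvexOn ℝ Set.univ (f i))
    (hsmooth : ∀ i x y, ‖f' i x - f' i y‖ ≤ L i * ‖x - y‖)
    (Lmax : ℝ) (hLmax : IsGreatest (Set.range L) Lmax)
    (xstar : EuclideanSpace ℝ (Fin d)) (hinterp : ∀ i, f' i xstar = 0)
    (μ : ℝ) (hμ : 0 < μ)
    (hsc : StrongConvexOn Set.univ μ (fun x => (1 / (n : ℝ)) * ∑ i, f i x))
    (γ : ℝ) (hγ : 0 < γ)
    (prox : Fin n → EuclideanSpace ℝ (Fin d) → EuclideanSpace ℝ (Fin d))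
    (hprox : ∀ i x, IsMinOn (fun z => f i z + ‖z - x‖ ^ 2 / (2 * γ)) Set.univ (prox i x))
    (hproxu : ∀ i x q, IsMinOn (fun z => f i z + ‖z - x‖ ^ 2 / (2 * γ)) Set.univ q → q = prox i x)
    (M : EuclideanSpace ℝ (Fin d) → ℝ)
    (hM : ∀ x, M x = (1 / (n : ℝ)) * ∑ i, (f i (prox i x) + ‖prox i x - x‖ ^ 2 / (2 * γ)))
    (M' : EuclideanSpace ℝ (Fin d) → EuclideanSpace ℝ (Fin d))
    (hM' : ∀ x, M' x = (1 / ((n : ℝ) * γ)) • ∑ i, (x - prox i x))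
    (hMdiff : ∀ x, HasGradientAt M (M' x) x)
    (x : EuclideanSpace ℝ (Fin d)) (xtil : Fin n → EuclideanSpace ℝ (Fin d))
    (ε₂ : ℝ) (hε₂ : 0 ≤ ε₂) (hε₂lt : ε₂ < 1)
    (happrox : ∀ i, ‖xtil i - prox i x‖ ^ 2 ≤ ε₂ * ‖x - prox i x‖ ^ 2)
    : ‖(1 / (n : ℝ)) • ∑ i, (xtil i - prox i x)‖ ^ 2 ≤ 4 * ε₂ * Lmax / μ * ‖γ • M' x‖ ^ 2 ∧
      (ε₂ < μ / (4 * Lmax) →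
        ‖(γ • M' x - (1 / (n : ℝ)) • ∑ i, (xtil i - prox i x)) - γ • M' x‖ ^ 2 ≤
          (1 - 1 / (μ / (μ - 4 * ε₂ * Lmax))) * ‖γ • M' x‖ ^ 2) := by
  have hn₀ : (0 : ℝ) < n := by exact_mod_cast hn
  obtain ⟨⟨j, rfl⟩, hmax⟩ := hLmax
  have hLj := hLpos j
  have hLip : ∀ i y z, ‖f' i y - f' i z‖ ≤ L j * ‖y - z‖ := fun i y z =>
    (hsmooth i y z).trans (mul_le_mul_of_nonneg_right (hmax ⟨i, rfl⟩) (norm_nonneg _))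
  have hmin : ∀ i y, f i xstar ≤ f i y := fun i y => by
    simpa [hinterp i] using (hconv i).add_inner_gradient_le (hdiff i xstar) y
  have hp : ∀ i, x - prox i x = γ • f' i (prox i x) := fun i =>
    sub_eq_smul_gradient_of_isMinOn_prox hγ (hdiff i _) (hprox i x)
  have hs : γ • M' x = (1 / (n : ℝ)) • ∑ i, (x - prox i x) := by
    rw [hM', smul_smul]
    congr 1
    field_simp
  have hinner : inner ℝ (γ • M' x) (x - xstar)
      = 1 / (n : ℝ) * ∑ i, inner ℝ (x - prox i x) (x - xstar) := by
    rw [hs, real_inner_smul_left, sum_inner]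
  have hA : (1 + γ * L j) * (1 / (n : ℝ) * ∑ i, ‖x - prox i x‖ ^ 2)
      ≤ 2 * γ * L j * inner ℝ (γ • M' x) (x - xstar) := by
    rw [hinner, mul_left_comm, mul_left_comm _ (1 / (n : ℝ))]
    refine mul_le_mul_of_nonneg_left ?_ (by positivity)
    rw [Finset.mul_sum, Finset.mul_sum]
    refine Finset.sum_le_sum fun i _ => ?_
    exact norm_sub_prox_sq_le hLj hγ (hconv i) (hdiff i) (hLip i) (hmin i) (hp i)
  have hc : γ * (μ / 2 * ‖x - xstar‖ ^ 2)
      ≤ (1 + γ * L j) * inner ℝ (γ • M' x) (x - xstar) := by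
    have hgrowth := hsc.quadratic_growth (x₀ := xstar)
      (fun y => by gcongr with i; exact hmin i y) x
    refine (mul_le_mul_of_nonneg_left hgrowth hγ.le).trans ?_
    rw [hinner, ← mul_sub, ← Finset.sum_sub_distrib, mul_left_comm,
      mul_left_comm _ (1 / (n : ℝ))]
    refine mul_le_mul_of_nonneg_left ?_ (by positivity)
    rw [Finset.mul_sum, Finset.mul_sum]
    refine Finset.sum_le_sum fun i _ => ?_
    exact mul_sub_le_inner_sub_prox hLj hγ (hconv i) (hdiff i) (hLip i) (hmin i) (hp i)
  have hmean : 1 / (n : ℝ) * ∑ i, ‖x - prox i x‖ ^ 2 ≤ 4 * L j / μ * ‖γ • M' x‖ ^ 2 :=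
    le_mul_sq_of_inner_bounds hLj hγ hμ (norm_nonneg _) hA hc (real_inner_le_norm _ _)
  have hbias : ‖(1 / (n : ℝ)) • ∑ i, (xtil i - prox i x)‖ ^ 2
      ≤ 4 * ε₂ * L j / μ * ‖γ • M' x‖ ^ 2 :=
    calc ‖(1 / (n : ℝ)) • ∑ i, (xtil i - prox i x)‖ ^ 2
        ≤ 1 / (n : ℝ) * ∑ i, ‖xtil i - prox i x‖ ^ 2 := by
          simpa using norm_mean_sq_le fun i => xtil i - prox i x
      _ ≤ 1 / (n : ℝ) * ∑ i, ε₂ * ‖x - prox i x‖ ^ 2 := by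
          gcongr with i
          exact happrox i
      _ = ε₂ * (1 / (n : ℝ) * ∑ i, ‖x - prox i x‖ ^ 2) := by
          rw [← Finset.mul_sum, mul_left_comm]
      _ ≤ ε₂ * (4 * L j / μ * ‖γ • M' x‖ ^ 2) := by gcongr
      _ = 4 * ε₂ * L j / μ * ‖γ • M' x‖ ^ 2 := by ring
  refine ⟨hbias, fun _ => ?_⟩
  have hδ : 1 - 1 / (μ / (μ - 4 * ε₂ * L j)) = 4 * ε₂ * L j / μ := by
    rw [one_div_div, sub_div, div_self hμ.ne', sub_sub_cancel]
  rw [hδ, sub_sub_cancel_left, norm_neg]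
  exact hbias
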